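/- Let E : I² → ℝ be a C², normalizable quasideviation whose quasideviation mean D_E (restricted to p variables, p ≥ 2) is C² near the diagonal. Then the residuum of D_E is ξ_{D_E}(x) = ∂_1²E(x,x) / ∂_1E(x,x) for all x ∈ I. -/

import Mathlib

open Filter Topology

/-- Differentiating the implicit equation `∑ i, F (y i, D y) = 0` in the direction `v`. -/
theorem sum_fderiv_apply_eq_zero {ι : Type*} [Fintype ι] {F : ℝ × ℝ → ℝ} {D : (ι → ℝ) → ℝ}
    {z : ι → ℝ} (hF : ∀ i, DifferentiableAt ℝ F (z i, D z)) (hD : DifferentiableAt ℝ D z)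
    (hzero : ∀ᶠ y in 𝓝 z, ∑ i, F (y i, D y) = 0) (v : ι → ℝ) :
    ∑ i, fderiv ℝ F (z i, D z) (v i, fderiv ℝ D z v) = 0 := by
  have hcomp : ∀ i, HasFDerivAt (fun y : ι → ℝ => F (y i, D y))
      ((fderiv ℝ F (z i, D z)).comp
        ((ContinuousLinearMap.proj (R := ℝ) (φ := fun _ : ι => ℝ) i).prod (fderiv ℝ D z))) z :=
    fun i => HasFDerivAt.comp (f := fun y : ι → ℝ => (y i, D y)) z (hF i).hasFDerivAt
      ((hasFDerivAt_apply i z).prodMk hD.hasFDerivAt)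
  have hsum := HasFDerivAt.fun_sum (u := Finset.univ) fun i _ => hcomp i
  have hconst : HasFDerivAt (fun y : ι → ℝ => ∑ i, F (y i, D y)) (0 : (ι → ℝ) →L[ℝ] ℝ) z :=
    (hasFDerivAt_const (0 : ℝ) z).congr_of_eventuallyEq hzero
  simpa using congrArg (fun L : (ι → ℝ) →L[ℝ] ℝ => L v) (hsum.unique hconst)

/-- Differentiating the implicit equation twice, in the directions `v` and then `w`. -/
theorem sum_second_fderiv_apply_eq_zero {ι : Type*} [Fintype ι] {F : ℝ × ℝ → ℝ}
    {D : (ι → ℝ) → ℝ} {z : ι → ℝ} (hF : ∀ i, ContDiffAt ℝ 2 F (z i, D z))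
    (hD : ContDiffAt ℝ 2 D z) (hzero : ∀ᶠ y in 𝓝 z, ∑ i, F (y i, D y) = 0) (v w : ι → ℝ) :
    ∑ i, (fderiv ℝ (fderiv ℝ F) (z i, D z) (w i, fderiv ℝ D z w) (v i, fderiv ℝ D z v)
      + fderiv ℝ F (z i, D z) (0, fderiv ℝ (fun y => fderiv ℝ D y v) z w)) = 0 := by
  have hdiffF : ∀ᶠ y in 𝓝 z, ∀ i, DifferentiableAt ℝ F (y i, D y) := by
    refine eventually_all.2 fun i => ?_
    have hcont : ContinuousAt (fun y : ι → ℝ => (y i, D y)) z :=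
      (continuous_apply i).continuousAt.prodMk hD.continuousAt
    exact hcont.eventually (((hF i).eventually (by simp)).mono
      fun q hq => hq.differentiableAt (by simp))
  have hdiffD : ∀ᶠ y in 𝓝 z, DifferentiableAt ℝ D y :=
    (hD.eventually (by simp)).mono fun y hy => hy.differentiableAt (by simp)
  have hfirst : ∀ᶠ y in 𝓝 z,
      ∑ i, fderiv ℝ F (y i, D y) (v i, fderiv ℝ D y v) = 0 := by
    filter_upwards [hdiffF, hdiffD, hzero.eventually_nhds] with y hy₁ hy₂ hy₃
    exact sum_fderiv_apply_eq_zero hy₁ hy₂ hy₃ v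
  have hDv : DifferentiableAt ℝ (fun y => fderiv ℝ D y v) z :=
    ((hD.fderiv_right (m := 1) (by norm_num)).differentiableAt (by simp)).clm_apply
      (differentiableAt_const v)
  have hcomp : ∀ i, HasFDerivAt
      (fun y : ι → ℝ => fderiv ℝ F (y i, D y) (v i, fderiv ℝ D y v)) _ z := fun i =>
    (HasFDerivAt.comp (f := fun y : ι → ℝ => (y i, D y)) z
      (((hF i).fderiv_right (m := 1) (by norm_num)).differentiableAt (by simp)).hasFDerivAt
      ((hasFDerivAt_apply i z).prodMk (hD.differentiableAt (by simp)).hasFDerivAt)).clm_apply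
      ((hasFDerivAt_const (v i) z).prodMk hDv.hasFDerivAt)
  have hsum := HasFDerivAt.fun_sum (u := Finset.univ) fun i _ => hcomp i
  have hconst : HasFDerivAt
      (fun y : ι → ℝ => ∑ i, fderiv ℝ F (y i, D y) (v i, fderiv ℝ D y v))
      (0 : (ι → ℝ) →L[ℝ] ℝ) z :=
    (hasFDerivAt_const (0 : ℝ) z).congr_of_eventuallyEq hfirst
  simpa [add_comm] using congrArg (fun L : (ι → ℝ) →L[ℝ] ℝ => L w) (hsum.unique hconst)

/-- residuum of a quasideviation mean: ξ_{D_E}(x) = ∂₁²E(x,x)/∂₁E(x,x). -/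
theorem residuum_quasideviation_mean (p : ℕ) (hp : 2 ≤ p) (I : Set ℝ) (hIopen : IsOpen I)
    (hIconn : I.OrdConnected) (E : ℝ → ℝ → ℝ)
    (hD1 : ∀ x ∈ I, ∀ u ∈ I, Real.sign (E x u) = Real.sign (x - u))
    (hD2 : ∀ x ∈ I, ContinuousOn (fun u => E x u) I)
    (hD3 : ∀ x ∈ I, ∀ y ∈ I, x < y →
      StrictAntiOn (fun u => E x u / E y u) (Set.Ioo x y))
    (hC2E : ContDiffOn ℝ 2 (fun q : ℝ × ℝ => E q.1 q.2) (I ×ˢ I))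
    (hnorm : ∀ x ∈ I, deriv (fun u => E x u) x < 0)
    (hnormcont : ContinuousOn (fun x => deriv (fun u => E x u) x) I)
    (D : (Fin p → ℝ) → ℝ)
    (hD : ∀ y : Fin p → ℝ, (∀ i, y i ∈ I) → D y ∈ I ∧ ∑ i, E (y i) (D y) = 0)
    (U : Set (Fin p → ℝ)) (hU : IsOpen U) (hdiag : ∀ x ∈ I, (fun _ => x) ∈ U)
    (hC2D : ContDiffOn ℝ 2 D U) :
    ∀ x ∈ I,
      -(p : ℝ)^2 * fderiv ℝ (fun z => fderiv ℝ D z (Pi.single (⟨1, hp⟩ : Fin p) 1))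
          (fun _ => x) (Pi.single (⟨0, by omega⟩ : Fin p) 1)
      = deriv (fun t => deriv (fun a => E a x) t) x / deriv (fun t => E t x) x := by
  intro x hx
  have hzero_iff : ∀ u ∈ I, ∀ t ∈ I, E t u = 0 ↔ t = u := by
    intro u hu t ht
    rw [← Real.sign_eq_zero_iff, hD1 t ht u hu, Real.sign_eq_zero_iff, sub_eq_zero]
  have hI : ∀ᶠ t in 𝓝 x, t ∈ I := hIopen.mem_nhds hx
  have hp0 : (p : ℝ) ≠ 0 := by positivity
  have hDx : D (fun _ => x) = x := by
    obtain ⟨hmem, hsum⟩ := hD (fun _ => x) fun _ => hx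
    have : (p : ℝ) * E x (D fun _ => x) = 0 := by simpa using hsum
    exact ((hzero_iff _ hmem x hx).1 ((mul_eq_zero.1 this).resolve_left hp0)).symm
  set F : ℝ × ℝ → ℝ := fun q => E q.1 q.2 with hFdef
  have hFx : ∀ t ∈ I, ContDiffAt ℝ 2 F (t, x) := fun t ht =>
    hC2E.contDiffAt ((hIopen.prod hIopen).mem_nhds ⟨ht, hx⟩)
  have hDC2 : ContDiffAt ℝ 2 D (fun _ => x) := hC2D.contDiffAt (hU.mem_nhds (hdiag x hx))
  have himplicit : ∀ᶠ y in 𝓝 (fun _ : Fin p => x), ∑ i, F (y i, D y) = 0 := by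
    have : ∀ᶠ y in 𝓝 (fun _ : Fin p => x), ∀ i, y i ∈ I :=
      eventually_all.2 fun i => (continuous_apply i).continuousAt.eventually hI
    exact this.mono fun y hy => (hD y hy).2
  have hdiagonal : ∀ᶠ y in 𝓝 (fun _ : Fin 1 => x), ∑ i, F (y i, y 0) = 0 := by
    filter_upwards [(continuous_apply (0 : Fin 1)).continuousAt.eventually hI] with y hy
    simpa [hFdef] using (hzero_iff (y 0) hy (y 0) hy).2 rfl
  have hfst : ∀ t ∈ I, HasDerivAt (fun a => E a x) (fderiv ℝ F (t, x) (1, 0)) t := fun t ht =>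
    HasFDerivAt.comp_hasDerivAt (f := fun a : ℝ => (a, x)) t
      ((hFx t ht).differentiableAt (by simp)).hasFDerivAt
      ((hasDerivAt_id t).prodMk (hasDerivAt_const t x))
  have hsnd : HasDerivAt (fun u => E x u) (fderiv ℝ F (x, x) (0, 1)) x :=
    HasFDerivAt.comp_hasDerivAt (f := fun u : ℝ => (x, u)) x
      ((hFx x hx).differentiableAt (by simp)).hasFDerivAt
      ((hasDerivAt_const x x).prodMk (hasDerivAt_id x))
  have hfst_fst : HasDerivAt (fun t => deriv (fun a => E a x) t)
      (fderiv ℝ (fderiv ℝ F) (x, x) (1, 0) (1, 0)) x := by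
    have hG := HasFDerivAt.comp_hasDerivAt (f := fun a : ℝ => (a, x)) x
      (((hFx x hx).fderiv_right (m := 1) (by norm_num)).differentiableAt
        (by simp)).hasFDerivAt ((hasDerivAt_id x).prodMk (hasDerivAt_const x x))
    have hG1 := hG.clm_apply (hasDerivAt_const x ((1 : ℝ), (0 : ℝ)))
    simp only [map_zero, add_zero] at hG1
    exact hG1.congr_of_eventuallyEq (hI.mono fun t ht => (hfst t ht).deriv)
  have hsymm : fderiv ℝ (fderiv ℝ F) (x, x) (1, 0) (0, 1)
      = fderiv ℝ (fderiv ℝ F) (x, x) (0, 1) (1, 0) :=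
    ((hFx x hx).isSymmSndFDerivAt (by simp)).eq _ _
  have hb : fderiv ℝ F (x, x) (0, 1) < 0 := hsnd.deriv ▸ hnorm x hx
  have hlin : ∀ (L : ℝ × ℝ →L[ℝ] ℝ) (c d : ℝ), L (c, d) = c * L (1, 0) + d * L (0, 1) := by
    intro L c d
    rw [← smul_eq_mul, ← smul_eq_mul, ← map_smul, ← map_smul, ← map_add]
    simp
  have hbilin : ∀ (B : ℝ × ℝ →L[ℝ] ℝ × ℝ →L[ℝ] ℝ) (a b c d : ℝ), B (a, b) (c, d)
      = a * c * B (1, 0) (1, 0) + a * d * B (1, 0) (0, 1)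
        + b * c * B (0, 1) (1, 0) + b * d * B (0, 1) (0, 1) := by
    intro B a b c d
    have : B (a, b) = a • B (1, 0) + b • B (0, 1) := by
      rw [← map_smul, ← map_smul, ← map_add]
      simp
    rw [hlin, this]
    simp only [add_apply, smul_apply, smul_eq_mul]
    ring
  rw [hfst_fst.deriv, (hfst x hx).deriv]
  have hproj : ∀ y : Fin 1 → ℝ, fderiv ℝ (fun y : Fin 1 → ℝ => y 0) y
      = ContinuousLinearMap.proj 0 := fun y => (hasFDerivAt_apply 0 y).fderiv
  have hdiag₁ := sum_fderiv_apply_eq_zero (D := fun y : Fin 1 → ℝ => y 0) (z := fun _ => x)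
    (fun _ => (hFx x hx).differentiableAt (by simp)) (by fun_prop) hdiagonal (fun _ => 1)
  have hdiag₂ := sum_second_fderiv_apply_eq_zero (D := fun y : Fin 1 → ℝ => y 0)
    (z := fun _ => x) (fun _ => hFx x hx) (by fun_prop) hdiagonal (fun _ => 1) (fun _ => 1)
  simp only [hproj] at hdiag₁ hdiag₂
  simp only [Finset.univ_unique, Finset.sum_singleton, ContinuousLinearMap.proj_apply,
    fderiv_fun_const, Pi.zero_apply, zero_apply] at hdiag₁ hdiag₂
  rw [hlin] at hdiag₁
  rw [hbilin, hlin (fderiv ℝ F (x, x))] at hdiag₂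
  have hmean₁ : ∀ j : Fin p, fderiv ℝ D (fun _ => x) (Pi.single j 1) = 1 / p := by
    intro j
    have h := sum_fderiv_apply_eq_zero
      (fun _ => by rw [hDx]; exact (hFx x hx).differentiableAt (by simp))
      (hDC2.differentiableAt (by simp)) himplicit (Pi.single j 1)
    rw [Finset.sum_congr rfl fun i _ => hlin _ _ _] at h
    simp only [hDx, Finset.sum_add_distrib, ← Finset.sum_mul, Finset.sum_pi_single', Finset.mem_univ,
      if_true, Finset.sum_const, Finset.card_univ, Fintype.card_fin, nsmul_eq_mul] at h
    rw [eq_div_iff hp0]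
    apply mul_right_cancel₀ hb.ne
    linarith
  have hmean₂ := sum_second_fderiv_apply_eq_zero (fun _ => by rw [hDx]; exact hFx x hx)
    hDC2 himplicit (Pi.single (⟨1, hp⟩ : Fin p) 1) (Pi.single (⟨0, by omega⟩ : Fin p) 1)
  set S := fderiv ℝ (fun y => fderiv ℝ D y (Pi.single (⟨1, hp⟩ : Fin p) 1)) (fun _ => x)
    (Pi.single (⟨0, by omega⟩ : Fin p) 1)
  have horth : ∀ i : Fin p, (Pi.single (⟨0, by omega⟩ : Fin p) 1 : Fin p → ℝ) i
      * (Pi.single (⟨1, hp⟩ : Fin p) 1 : Fin p → ℝ) i = 0 := by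
    intro i
    by_cases h : i = ⟨0, by omega⟩ <;> simp [Pi.single_apply, h]
  rw [Finset.sum_congr rfl fun i _ => congrArg₂ (· + ·) (hbilin _ _ _ _ _) (hlin _ _ _)] at hmean₂
  simp only [hDx, hmean₁, horth] at hmean₂
  simp only [Finset.sum_add_distrib, ← Finset.sum_mul, ← Finset.mul_sum, Finset.sum_pi_single',
    Finset.mem_univ, if_true, Finset.sum_const, Finset.card_univ, Fintype.card_fin,
    nsmul_eq_mul] at hmean₂
  have ha : fderiv ℝ F (x, x) (1, 0) = -fderiv ℝ F (x, x) (0, 1) := by linarith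
  rw [ha, eq_div_iff (neg_ne_zero.2 hb.ne)]
  rw [hsymm] at hdiag₂ hmean₂
  field_simp at hmean₂
  linarith
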